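/- For every positive integer n, there exists k = k(n) such that every graph G containing a vertex set A of size k shattered by a disjoint set of vertices contains one of the following as an induced subgraph: W_n, the complement of W_n, D_n, or the complement of D_n. Here W_n is the bipartite graph with parts of size n and 2^n realizing all subsets, and D_n is obtained from W_n by making the part of size n a clique. -/

import Mathlib

/-- `Wgraph n` : the bipartite graph with parts `Fin n` and `Finset (Fin n)`, where
`a` is adjacent to `s` iff `a ∈ s` (realizing all `2^n` subsets). -/
def Wgraph (n : ℕ) : SimpleGraph (Fin n ⊕ Finset (Fin n)) :=
  SimpleGraph.fromRel (fun u v => ∃ a s, u = Sum.inl a ∧ v = Sum.inr s ∧ a ∈ s)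

/-- `Dgraph n` : the split graph obtained from `Wgraph n` by making the part of size `n`
a clique. -/
def Dgraph (n : ℕ) : SimpleGraph (Fin n ⊕ Finset (Fin n)) :=
  SimpleGraph.fromRel (fun u v =>
    (∃ a s, u = Sum.inl a ∧ v = Sum.inr s ∧ a ∈ s) ∨
    (∃ a b : Fin n, u = Sum.inl a ∧ v = Sum.inl b))

/-- The elements of `B` realize every subset of `X` as a trace of the relation `R`. -/
def RelShatters {V X : Type} (R : V → X → Prop) (B : Set V) : Prop :=
  ∀ S : Set X, ∃ v ∈ B, ∀ x, R v x ↔ x ∈ S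

theorem RelShatters.comp {V X Y : Type} {R : V → X → Prop} {B : Set V}
    (h : RelShatters R B) {e : Y → X} (he : Function.Injective e) :
    RelShatters (fun v y => R v (e y)) B := by
  intro S
  obtain ⟨v, hv, hS⟩ := h (e '' S)
  exact ⟨v, hv, fun y => (hS (e y)).trans he.mem_set_image⟩

/-- If a set shattering a disjoint union is split into two classes, then the first class shatters
the first summand or the second class shatters the second one. -/
theorem RelShatters.split {V X Y : Type} {R : V → X ⊕ Y → Prop} {B : Set V}
    (h : RelShatters R B) (p : V → Prop) :
    RelShatters (fun v x => R v (Sum.inl x)) {v ∈ B | p v} ∨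
      RelShatters (fun v y => R v (Sum.inr y)) {v ∈ B | ¬ p v} := by
  by_contra! hcon
  obtain ⟨h₁, h₂⟩ := hcon
  unfold RelShatters at h₁ h₂
  push Not at h₁ h₂
  obtain ⟨S, hS⟩ := h₁
  obtain ⟨T, hT⟩ := h₂
  obtain ⟨v, hv, hvST⟩ := h (Sum.inl '' S ∪ Sum.inr '' T)
  by_cases hp : p v
  · obtain ⟨x, hx⟩ := hS v ⟨hv, hp⟩
    have := hvST (Sum.inl x)
    simp at this
    tauto
  · obtain ⟨y, hy⟩ := hT v ⟨hv, hp⟩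
    have := hvST (Sum.inr y)
    simp at this
    tauto

/-- Blocks of points indexed by `ι` and jointly shattered admit a transversal and vertices
realizing a prescribed family `P` of subsets of `ι` on it, two-coloured so that each colour class
is a clique or an independent set, respectively. -/
theorem exists_transversal_homogeneous {ι : Type} (P : Finset (Finset ι)) :
    ∃ (K : Type) (_ : Fintype K), ∀ (V : Type) (G : SimpleGraph V) (f : ι × K → V) (B : Set V),
      RelShatters (fun v x => G.Adj v (f x)) B →
      ∃ (g : ι → K) (v : Finset ι → V) (c : Finset ι → Prop),
        (∀ C ∈ P, v C ∈ B ∧ ∀ i, G.Adj (v C) (f (i, g i)) ↔ i ∈ C) ∧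
        ∀ C ∈ P, ∀ D ∈ P, C ≠ D →
          (c C → c D → G.Adj (v C) (v D)) ∧ (¬ c C → ¬ c D → ¬ G.Adj (v C) (v D)) := by
  classical
  induction P using Finset.induction_on with
  | empty =>
    refine ⟨Unit, inferInstance, fun V G f B h => ?_⟩
    obtain ⟨v, -, -⟩ := h ∅
    exact ⟨fun _ => (), fun _ => v, fun _ => True, by simp, by simp⟩
  | insert C₀ P hC₀ ih =>
    obtain ⟨K, hK, ih⟩ := ih
    refine ⟨K ⊕ K, inferInstance, fun V G f B h => ?_⟩
    obtain ⟨v₀, hv₀, hadj₀⟩ := h {x | x.1 ∈ C₀}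
    obtain ⟨e, b, he, hb⟩ : ∃ (e : K → K ⊕ K) (b : Prop),
        Function.Injective e ∧
        RelShatters (fun v (x : ι × K) => G.Adj v (f (x.1, e x.2))) {v ∈ B | G.Adj v₀ v ↔ b} := by
      have h' := h.comp (Equiv.prodSumDistrib ι K K).symm.injective
      rcases h'.split (fun v => G.Adj v₀ v) with h₁ | h₁
      · exact ⟨Sum.inl, True, Sum.inl_injective, by simpa using h₁⟩
      · exact ⟨Sum.inr, False, Sum.inr_injective, by simpa using h₁⟩
    obtain ⟨g, v, c, hv, hc⟩ := ih V G (fun x => f (x.1, e x.2)) _ hb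
    refine ⟨fun i => e (g i), Function.update v C₀ v₀, Function.update c C₀ b, ?_, ?_⟩
    · intro C hC
      by_cases hCC : C = C₀
      · subst hCC
        simpa [hv₀] using fun i => hadj₀ (i, e (g i))
      · have hCP := Finset.mem_of_mem_insert_of_ne hC hCC
        simpa [hCC] using ⟨(hv C hCP).1.1, (hv C hCP).2⟩
    · intro C hC D hD hCD
      by_cases hCC : C = C₀
      · subst hCC
        have hDP := Finset.mem_of_mem_insert_of_ne hD hCD.symm
        have := (hv D hDP).1.2
        simp only [Function.update_self, Function.update_of_ne hCD.symm]
        tauto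
      · have hCP := Finset.mem_of_mem_insert_of_ne hC hCC
        by_cases hDD : D = C₀
        · subst hDD
          have := (hv C hCP).1.2
          rw [G.adj_comm] at this
          simp only [Function.update_self, Function.update_of_ne hCD]
          tauto
        · have hDP := Finset.mem_of_mem_insert_of_ne hD hDD
          simpa [hCC, hDD] using hc C hCP D hDP hCD

/-- Finite Ramsey theorem for graphs. -/
theorem exists_clique_or_indep (p q : ℕ) :
    ∃ N : ℕ, ∀ (V : Type) (G : SimpleGraph V) (A : Finset V), N ≤ A.card →
      (∃ S ⊆ A, S.card = p ∧ ∀ x ∈ S, ∀ y ∈ S, x ≠ y → G.Adj x y) ∨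
      (∃ S ⊆ A, S.card = q ∧ ∀ x ∈ S, ∀ y ∈ S, x ≠ y → ¬ G.Adj x y) := by
  classical
  induction p generalizing q with
  | zero => exact ⟨0, fun V G A _ => Or.inl ⟨∅, by simp⟩⟩
  | succ p ihp =>
    induction q with
    | zero => exact ⟨0, fun V G A _ => Or.inr ⟨∅, by simp⟩⟩
    | succ q ihq =>
      obtain ⟨N₁, h₁⟩ := ihp (q + 1)
      obtain ⟨N₂, h₂⟩ := ihq
      refine ⟨N₁ + N₂ + 1, fun V G A hA => ?_⟩
      obtain ⟨a, ha⟩ : A.Nonempty := Finset.card_pos.1 (by omega)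
      have hcard := Finset.card_filter_add_card_filter_not (s := A.erase a) (fun x => G.Adj a x)
      rw [Finset.card_erase_of_mem ha] at hcard
      rcases le_or_gt N₁ ((A.erase a).filter (fun x => G.Adj a x)).card with h | h
      · rcases h₁ V G _ h with ⟨S, hS, hSc, hSa⟩ | ⟨S, hS, hSc, hSa⟩
        · have hS' : ∀ x ∈ S, x ≠ a ∧ x ∈ A ∧ G.Adj a x := fun x hx => by
            simpa [and_assoc] using hS hx
          refine Or.inl ⟨insert a S, ?_, ?_, ?_⟩
          · exact Finset.insert_subset ha fun x hx => (hS' x hx).2.1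
          · rw [Finset.card_insert_of_notMem fun hx => (hS' a hx).1 rfl, hSc]
          · grind [G.adj_comm]
        · exact Or.inr ⟨S, fun x hx => Finset.mem_of_mem_erase
            (Finset.mem_of_mem_filter x (hS hx)), hSc, hSa⟩
      · have h' : N₂ ≤ ((A.erase a).filter (fun x => ¬ G.Adj a x)).card := by omega
        rcases h₂ V G _ h' with ⟨S, hS, hSc, hSa⟩ | ⟨S, hS, hSc, hSa⟩
        · exact Or.inl ⟨S, fun x hx => Finset.mem_of_mem_erase
            (Finset.mem_of_mem_filter x (hS hx)), hSc, hSa⟩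
        · have hS' : ∀ x ∈ S, x ≠ a ∧ x ∈ A ∧ ¬ G.Adj a x := fun x hx => by
            simpa [and_assoc] using hS hx
          refine Or.inr ⟨insert a S, ?_, ?_, ?_⟩
          · exact Finset.insert_subset ha fun x hx => (hS' x hx).2.1
          · rw [Finset.card_insert_of_notMem fun hx => (hS' a hx).1 rfl, hSc]
          · grind [G.adj_comm]

theorem exists_homogeneous_subset (m : ℕ) :
    ∃ N : ℕ, ∀ (V : Type) (G : SimpleGraph V) (A : Finset V), N ≤ A.card →
      ∃ S ⊆ A, S.card = m ∧ ∃ b : Prop, ∀ x ∈ S, ∀ y ∈ S, x ≠ y → (G.Adj x y ↔ b) := by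
  obtain ⟨N, hN⟩ := exists_clique_or_indep m m
  refine ⟨N, fun V G A hA => ?_⟩
  rcases hN V G A hA with ⟨S, hS, hSc, h⟩ | ⟨S, hS, hSc, h⟩
  · exact ⟨S, hS, hSc, True, by simpa using h⟩
  · exact ⟨S, hS, hSc, False, by simpa using h⟩

/-- Homogeneous vertices `a i` and homogeneous vertices `w C` realizing all traces induce one of
the four unavoidable graphs. -/
theorem embedding_of_homogeneous {n : ℕ} {V : Type} (G : SimpleGraph V) (a : Fin n → V)
    (w : Finset (Fin n) → V) (hne : ∀ i C, a i ≠ w C)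
    (hadj : ∀ C i, G.Adj (w C) (a i) ↔ i ∈ C) (bA bB : Prop)
    (ha : ∀ i j, i ≠ j → (G.Adj (a i) (a j) ↔ bA))
    (hw : ∀ C D, C ≠ D → (G.Adj (w C) (w D) ↔ bB)) :
    Nonempty (Wgraph n ↪g G) ∨ Nonempty ((Wgraph n)ᶜ ↪g G) ∨
      Nonempty (Dgraph n ↪g G) ∨ Nonempty ((Dgraph n)ᶜ ↪g G) := by
  have hai : Function.Injective a := fun i j hij => by
    have h₁ := hadj {i} i
    have h₂ := hadj {i} j
    rw [hij] at h₁
    exact (Finset.mem_singleton.1 (h₂.1 (h₁.2 (Finset.mem_singleton_self i)))).symm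
  have hwi : Function.Injective w := fun C D hCD => by
    ext i
    rw [← hadj C i, ← hadj D i, hCD]
  have hwc : Function.Injective fun C => w Cᶜ := fun C D h => compl_injective (hwi h)
  have hadj' : ∀ C i, G.Adj (a i) (w C) ↔ i ∈ C := fun C i => by rw [G.adj_comm, hadj]
  have hwn : ∀ C D, C ≠ D → (G.Adj (w Cᶜ) (w Dᶜ) ↔ bB) := fun C D h =>
    hw _ _ (compl_injective.ne h)
  by_cases hB : bB <;> by_cases hA : bA
  · refine Or.inr (Or.inl ⟨⟨⟨Sum.elim a fun C => w Cᶜ, hai.sumElim hwc fun i C => hne i _⟩, ?_⟩⟩)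
    rintro (i | C) (j | D)
    · by_cases h : i = j <;> simp [Wgraph, h, ha, hA]
    · simp [Wgraph, hadj']
    · simp [Wgraph, hadj]
    · by_cases h : C = D <;> simp [Wgraph, h, hwn, hB]
  · refine Or.inr (Or.inr (Or.inr
      ⟨⟨⟨Sum.elim a fun C => w Cᶜ, hai.sumElim hwc fun i C => hne i _⟩, ?_⟩⟩))
    rintro (i | C) (j | D)
    · by_cases h : i = j <;> simp [Dgraph, h, ha, hA]
    · simp [Dgraph, hadj']
    · simp [Dgraph, hadj]
    · by_cases h : C = D <;> simp [Dgraph, h, hwn, hB]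
  · refine Or.inr (Or.inr (Or.inl ⟨⟨⟨Sum.elim a w, hai.sumElim hwi hne⟩, ?_⟩⟩))
    rintro (i | C) (j | D)
    · by_cases h : i = j <;> simp [Dgraph, h, ha, hA]
    · simp [Dgraph, hadj']
    · simp [Dgraph, hadj]
    · by_cases h : C = D <;> simp [Dgraph, h, hw, hB]
  · refine Or.inl ⟨⟨⟨Sum.elim a w, hai.sumElim hwi hne⟩, ?_⟩⟩
    rintro (i | C) (j | D)
    · by_cases h : i = j <;> simp [Wgraph, h, ha, hA]
    · simp [Wgraph, hadj']
    · simp [Wgraph, hadj]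
    · by_cases h : C = D <;> simp [Wgraph, h, hw, hB]

/-- For every `n` there is `k` such that every graph containing a set `A` of `k` vertices
shattered by a disjoint set of vertices contains one of `W_n`, its complement, `D_n`, or
its complement as an induced subgraph. -/
theorem shattered_set_unavoidable (n : ℕ) (hn : 0 < n) :
    ∃ k : ℕ, ∀ (V : Type) (G : SimpleGraph V) (A B : Finset V),
      Disjoint A B → A.card = k →
      (∀ C : Finset V, C ⊆ A → ∃ v ∈ B, ∀ a ∈ A, (G.Adj v a ↔ a ∈ C)) →
      Nonempty (Wgraph n ↪g G) ∨ Nonempty ((Wgraph n)ᶜ ↪g G) ∨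
      Nonempty (Dgraph n ↪g G) ∨ Nonempty ((Dgraph n)ᶜ ↪g G) := by
  classical
  obtain ⟨K, hK, htrans⟩ :=
    exists_transversal_homogeneous (Finset.univ : Finset (Finset (Fin n ⊕ Fin n)))
  obtain ⟨k, hk⟩ := exists_homogeneous_subset (Fintype.card ((Fin n ⊕ Fin n) × K))
  refine ⟨k, fun V G A B hAB hA hsh => ?_⟩
  obtain ⟨S, hSA, hSc, bA, hS⟩ := hk V G A hA.ge
  have φ : (Fin n ⊕ Fin n) × K ≃ S := Fintype.equivOfCardEq (by simp [← hSc])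
  have hφ : Function.Injective fun x => (φ x : V) := Subtype.val_injective.comp φ.injective
  obtain ⟨g, v, c, hv, hc⟩ := htrans V G (fun x => φ x) B (by
    intro T
    obtain ⟨v, hvB, hv⟩ := hsh ((Finset.univ.filter (· ∈ T)).image fun x => (φ x : V))
      (by
        intro y hy
        obtain ⟨x, -, rfl⟩ := Finset.mem_image.1 hy
        exact hSA (φ x).2)
    refine ⟨v, hvB, fun x => (hv _ (hSA (φ x).2)).trans ?_⟩
    rw [hφ.mem_finset_image]
    simp)
  obtain ⟨e, bB, he, hb⟩ : ∃ (e : Fin n → Fin n ⊕ Fin n) (b : Prop), Function.Injective e ∧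
      RelShatters (fun (C : Finset (Fin n ⊕ Fin n)) i => e i ∈ C) {C | c C ↔ b} := by
    have hall : RelShatters (fun (C : Finset (Fin n ⊕ Fin n)) i => i ∈ C) Set.univ :=
      fun T => ⟨Finset.univ.filter (· ∈ T), trivial, by simp⟩
    rcases hall.split c with h | h
    · exact ⟨Sum.inl, True, Sum.inl_injective, by simpa using h⟩
    · exact ⟨Sum.inr, False, Sum.inr_injective, by simpa using h⟩
  choose F hFc hF using fun C : Finset (Fin n) => hb (C : Set (Fin n))
  have hFi : Function.Injective F := fun C D h => by
    ext i
    have h₁ := hF C i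
    rw [h, hF D i] at h₁
    simpa using h₁.symm
  refine embedding_of_homogeneous G (fun i => φ (e i, g (e i))) (fun C => v (F C)) ?_ ?_ bA bB ?_ ?_
  · intro i C h
    exact Finset.disjoint_left.1 hAB (hSA (φ _).2) (h ▸ (hv (F C) (Finset.mem_univ _)).1)
  · intro C i
    rw [(hv (F C) (Finset.mem_univ _)).2]
    exact hF C i
  · intro i j hij
    exact hS _ (φ _).2 _ (φ _).2 (hφ.ne fun h => hij (he (congrArg Prod.fst h)))
  · intro C D hCD
    have h := hc _ (Finset.mem_univ (F C)) _ (Finset.mem_univ (F D)) (hFi.ne hCD)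
    have h₁ : c (F C) ↔ bB := hFc C
    have h₂ : c (F D) ↔ bB := hFc D
    tauto
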